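/- Let h ≥ 0, 0 ≤ k ≤ m, 0 ≤ s ≤ m−h, s+h ≤ n. Let V = ⟨e_1,…,e_s⟩, V' = ⟨e_1,…,e_{s+h}⟩ ⊆ F_q^n, U = ⟨e_1,…,e_k⟩ ⊆ F_q^m, and C = Mat(V) + (Mat(U)^t ∩ Mat(V')) ⊆ F_q^{n×m}. Then for every subspace J ⊆ F_q^n: dim(C) − dim(C ∩ Mat(J^⊥)) = m·(s − dim(V ∩ J^⊥)) + k·(h + dim(V ∩ J^⊥) − dim(V' ∩ J^⊥)); equivalently, the column rank function satisfies ρ_c(C,J) = s − dim(V ∩ J^⊥) + k(h + dim(V ∩ J^⊥) − dim(V' ∩ J^⊥))/m. -/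

import Mathlib

open Matrix

/-- The maximum rank of a rank-metric code (an `𝔽`-linear subspace of `n × m` matrices). -/
noncomputable def maxrk {𝔽 : Type*} [Field 𝔽] {n m : ℕ}
    (C : Submodule 𝔽 (Matrix (Fin n) (Fin m) 𝔽)) : ℕ :=
  sSup (Matrix.rank '' (C : Set (Matrix (Fin n) (Fin m) 𝔽)))

/-- The dual code with respect to the trace bilinear form `⟨M, N⟩ = Tr(M Nᵗ)`. -/
def dualCode {𝔽 : Type*} [Field 𝔽] {n m : ℕ}
    (C : Submodule 𝔽 (Matrix (Fin n) (Fin m) 𝔽)) :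
    Submodule 𝔽 (Matrix (Fin n) (Fin m) 𝔽) where
  carrier := {M | ∀ N ∈ C, Matrix.trace (M * Nᵀ) = 0}
  add_mem' := by
    intro a b ha hb N hN
    show Matrix.trace ((a + b) * Nᵀ) = 0
    rw [Matrix.add_mul, Matrix.trace_add, ha N hN, hb N hN, add_zero]
  zero_mem' := by
    intro N hN
    simp
  smul_mem' := by
    intro c a ha N hN
    show Matrix.trace ((c • a) * Nᵀ) = 0
    rw [Matrix.smul_mul, Matrix.trace_smul, ha N hN, smul_zero]

/-- `C` is an optimal anticode if `dim C = m * maxrk C`. -/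
def isOptAnticode {𝔽 : Type*} [Field 𝔽] {n m : ℕ}
    (C : Submodule 𝔽 (Matrix (Fin n) (Fin m) 𝔽)) : Prop :=
  Module.finrank 𝔽 C = m * maxrk C

/-- `C` is a quasi optimal anticode if `m ∤ dim C` and `maxrk C = ⌈dim C / m⌉`. -/
def isQOAC {𝔽 : Type*} [Field 𝔽] {n m : ℕ}
    (C : Submodule 𝔽 (Matrix (Fin n) (Fin m) 𝔽)) : Prop :=
  ¬ (m ∣ Module.finrank 𝔽 C) ∧
    (maxrk C : ℤ) = ⌈(Module.finrank 𝔽 C : ℚ) / (m : ℚ)⌉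

/-- `C` is a dually quasi optimal anticode if both `C` and `C^⊥` are qOACs. -/
def isDuallyQOAC {𝔽 : Type*} [Field 𝔽] {n m : ℕ}
    (C : Submodule 𝔽 (Matrix (Fin n) (Fin m) 𝔽)) : Prop :=
  isQOAC C ∧ isQOAC (dualCode C)

/-- The code of matrices vanishing at all positions `(i, j)` with `¬ P i j`. -/
def zeroOutside {𝔽 : Type*} [Field 𝔽] {n m : ℕ} (P : Fin n → Fin m → Prop) :
    Submodule 𝔽 (Matrix (Fin n) (Fin m) 𝔽) where
  carrier := {M | ∀ i j, ¬ P i j → M i j = 0}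
  add_mem' := by
    intro a b ha hb i j h
    simp [Matrix.add_apply, ha i j h, hb i j h]
  zero_mem' := by
    intro i j h
    simp
  smul_mem' := by
    intro c a ha i j h
    simp [Matrix.smul_apply, ha i j h]

/-- `Mat(V)`: the matrices all of whose columns lie in `V ⊆ 𝔽^n`. -/
def matCol {𝔽 : Type*} [Field 𝔽] {n m : ℕ} (V : Submodule 𝔽 (Fin n → 𝔽)) :
    Submodule 𝔽 (Matrix (Fin n) (Fin m) 𝔽) where
  carrier := {M | ∀ j, (fun i => M i j) ∈ V}
  add_mem' := by
    intro a b ha hb j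
    exact V.add_mem (ha j) (hb j)
  zero_mem' := by
    intro j
    exact V.zero_mem
  smul_mem' := by
    intro c a ha j
    exact V.smul_mem c (ha j)

/-- `Mat(U)ᵗ`: the matrices all of whose rows lie in `U ⊆ 𝔽^m`. -/
def matRow {𝔽 : Type*} [Field 𝔽] {n m : ℕ} (U : Submodule 𝔽 (Fin m → 𝔽)) :
    Submodule 𝔽 (Matrix (Fin n) (Fin m) 𝔽) where
  carrier := {M | ∀ i, M i ∈ U}
  add_mem' := by
    intro a b ha hb i
    exact U.add_mem (ha i) (hb i)
  zero_mem' := by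
    intro i
    exact U.zero_mem
  smul_mem' := by
    intro c a ha i
    exact U.smul_mem c (ha i)

/-- `⟨e_1, …, e_s⟩ ⊆ 𝔽^ℓ`: the span of the first `s` canonical basis vectors. -/
def spanFirst (𝔽 : Type*) [Field 𝔽] (ℓ s : ℕ) : Submodule 𝔽 (Fin ℓ → 𝔽) :=
  Submodule.span 𝔽 ((fun i : Fin ℓ => Pi.single i (1 : 𝔽)) '' {i : Fin ℓ | (i : ℕ) < s})

/-- Orthogonal complement with respect to the standard dot product on `𝔽^ℓ`. -/
def perp {𝔽 : Type*} [Field 𝔽] {ℓ : ℕ} (W : Submodule 𝔽 (Fin ℓ → 𝔽)) :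
    Submodule 𝔽 (Fin ℓ → 𝔽) where
  carrier := {v | ∀ w ∈ W, ∑ i, v i * w i = 0}
  add_mem' := by
    intro a b ha hb w hw
    simp [add_mul, Finset.sum_add_distrib, ha w hw, hb w hw]
  zero_mem' := by
    intro w hw
    simp
  smul_mem' := by
    intro c a ha w hw
    simp [mul_assoc, ← Finset.mul_sum, ha w hw]

/-- Equivalence of rank-metric codes: `C = {N A M : A ∈ D}` for invertible `N, M`, or
(when `n = m`) `C = {N Aᵗ M : A ∈ D}` for invertible `N, M`. -/
def equivCode {𝔽 : Type*} [Field 𝔽] {n m : ℕ}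
    (C D : Submodule 𝔽 (Matrix (Fin n) (Fin m) 𝔽)) : Prop :=
  (∃ (N : Matrix (Fin n) (Fin n) 𝔽) (M : Matrix (Fin m) (Fin m) 𝔽),
      IsUnit N ∧ IsUnit M ∧
      (C : Set (Matrix (Fin n) (Fin m) 𝔽)) = (fun A : Matrix (Fin n) (Fin m) 𝔽 => N * A * M) '' (D : Set (Matrix (Fin n) (Fin m) 𝔽))) ∨
  (∃ (h : n = m) (N : Matrix (Fin n) (Fin n) 𝔽) (M : Matrix (Fin m) (Fin m) 𝔽),
      IsUnit N ∧ IsUnit M ∧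
      (C : Set (Matrix (Fin n) (Fin m) 𝔽)) =
        (fun A : Matrix (Fin n) (Fin m) 𝔽 =>
          N * (Matrix.reindex (finCongr h.symm) (finCongr h) Aᵀ) * M) ''
          (D : Set (Matrix (Fin n) (Fin m) 𝔽)))

/-- The Gaussian `q`-binomial coefficient, as a rational number. -/
def gaussBinom (q a r : ℕ) : ℚ :=
  (∏ i ∈ Finset.range r, ((q : ℚ) ^ a - (q : ℚ) ^ i)) /
    (∏ i ∈ Finset.range r, ((q : ℚ) ^ r - (q : ℚ) ^ i))

/-- `φ_q(a, b, r)`: the number of rank-`r` matrices in `𝔽_q^{a×b}`. -/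
def phiq (q a b r : ℕ) : ℚ :=
  gaussBinom q a r * ∏ i ∈ Finset.range r, ((q : ℚ) ^ b - (q : ℚ) ^ i)

theorem mem_spanFirst {𝔽 : Type*} [Field 𝔽] {ℓ s : ℕ} {v : Fin ℓ → 𝔽} :
    v ∈ spanFirst 𝔽 ℓ s ↔ ∀ i : Fin ℓ, s ≤ (i : ℕ) → v i = 0 := by
  constructor
  · intro hv
    refine Submodule.span_induction ?_ ?_ ?_ ?_ hv
    · rintro _ ⟨j, hj, rfl⟩ i hi
      have hij : i ≠ j := by
        rintro rfl
        exact absurd hj (not_lt.mpr hi)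
      simp [hij]
    · intro i _
      rfl
    · intro x y _ _ hx hy i hi
      simp [hx i hi, hy i hi]
    · intro a x _ hx i hi
      simp [hx i hi]
  · intro hv
    rw [pi_eq_sum_univ' v]
    refine Submodule.sum_mem _ fun i _ => ?_
    by_cases hi : (i : ℕ) < s
    · refine Submodule.smul_mem _ _ (Submodule.subset_span ⟨i, hi, ?_⟩)
      ext j
      simp [Pi.single_apply, eq_comm]
    · simp [hv i (not_lt.mp hi)]

theorem spanFirst_mono {𝔽 : Type*} [Field 𝔽] {ℓ s t : ℕ} (hst : s ≤ t) :
    spanFirst 𝔽 ℓ s ≤ spanFirst 𝔽 ℓ t := fun _ hv =>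
  mem_spanFirst.mpr fun i hi => mem_spanFirst.mp hv i (hst.trans hi)

theorem finrank_spanFirst {𝔽 : Type*} [Field 𝔽] {ℓ s : ℕ} (hs : s ≤ ℓ) :
    Module.finrank 𝔽 (spanFirst 𝔽 ℓ s) = s := by
  have hrange : spanFirst 𝔽 ℓ s = Submodule.span 𝔽
      (Set.range fun i : Fin s => (Pi.single (Fin.castLE hs i) 1 : Fin ℓ → 𝔽)) := by
    unfold spanFirst
    congr 1
    ext v
    constructor
    · rintro ⟨i, hi, rfl⟩
      exact ⟨⟨i, hi⟩, rfl⟩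
    · rintro ⟨i, rfl⟩
      exact ⟨Fin.castLE hs i, i.isLt, rfl⟩
  have hli : LinearIndependent 𝔽
      (fun i : Fin s => (Pi.single (Fin.castLE hs i) 1 : Fin ℓ → 𝔽)) :=
    (Pi.linearIndependent_single_one (Fin ℓ) 𝔽).comp _ (Fin.castLE_injective hs)
  rw [hrange, finrank_span_eq_card hli, Fintype.card_fin]

/-- The code of matrices whose `j`-th column ranges over `S j` has dimension `∑ j, dim (S j)`. -/
theorem finrank_eq_sum_of_forall_col_mem {𝔽 : Type*} [Field 𝔽] {n m : ℕ}
    {C : Submodule 𝔽 (Matrix (Fin n) (Fin m) 𝔽)} {S : Fin m → Submodule 𝔽 (Fin n → 𝔽)}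
    (hC : ∀ M, M ∈ C ↔ ∀ j, (fun i => M i j) ∈ S j) :
    Module.finrank 𝔽 C = ∑ j, Module.finrank 𝔽 (S j) := by
  let e : C ≃ₗ[𝔽] ((j : Fin m) → S j) :=
    { toFun := fun M j => ⟨fun i => M.1 i j, (hC M.1).mp M.2 j⟩
      map_add' := fun _ _ => rfl
      map_smul' := fun _ _ => rfl
      invFun := fun f => ⟨Matrix.of fun i j => (f j).1 i, (hC _).mpr fun j => (f j).2⟩
      left_inv := fun _ => rfl
      right_inv := fun _ => rfl }
  rw [e.finrank_eq, Module.finrank_pi_fintype]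

theorem sum_ite_val_lt {m k : ℕ} (hkm : k ≤ m) (a b : ℕ) :
    ∑ j : Fin m, (if (j : ℕ) < k then a else b) = k * a + (m - k) * b := by
  rw [Fin.sum_univ_eq_sum_range (fun j => if j < k then a else b),
    ← Finset.sum_range_add_sum_Ico _ hkm]
  congr 1
  · rw [Finset.sum_congr rfl fun j hj => if_pos (Finset.mem_range.mp hj)]
    simp
  · rw [Finset.sum_congr rfl fun j hj => if_neg (not_lt.mpr (Finset.mem_Ico.mp hj).1)]
    simp

theorem mem_matCol_sup_iff {𝔽 : Type*} [Field 𝔽] {n m k : ℕ}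
    {V V' : Submodule 𝔽 (Fin n → 𝔽)} (hV : V ≤ V') (M : Matrix (Fin n) (Fin m) 𝔽) :
    M ∈ matCol V ⊔ (matRow (spanFirst 𝔽 m k) ⊓ matCol V') ↔
      ∀ j : Fin m, (fun i => M i j) ∈ if (j : ℕ) < k then V' else V := by
  constructor
  · intro hM j
    obtain ⟨A, hA, B, ⟨hBr, hBc⟩, rfl⟩ := Submodule.mem_sup.mp hM
    split_ifs with hj
    · exact V'.add_mem (hV (hA j)) (hBc j)
    · have hB : ∀ i, B i j = 0 := fun i => mem_spanFirst.mp (hBr i) j (not_lt.mp hj)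
      simpa [hB] using hA j
  · intro hM
    refine Submodule.mem_sup.mpr
      ⟨Matrix.of fun i j => if (j : ℕ) < k then 0 else M i j, fun j => ?_,
        Matrix.of fun i j => if (j : ℕ) < k then M i j else 0, ⟨fun i => ?_, fun j => ?_⟩, ?_⟩
    · have hj := hM j
      by_cases hk : (j : ℕ) < k
      · simp only [Matrix.of_apply, if_pos hk]
        exact V.zero_mem
      · simpa only [Matrix.of_apply, if_neg hk] using hj
    · refine mem_spanFirst.mpr fun j hj => ?_
      simp [not_lt.mpr hj]
    · have hj := hM j
      by_cases hk : (j : ℕ) < k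
      · simpa only [Matrix.of_apply, if_pos hk] using hj
      · simp only [Matrix.of_apply, if_neg hk]
        exact V'.zero_mem
    · ext i j
      by_cases hk : (j : ℕ) < k <;> simp [hk]

theorem finrank_inf_add_finrank_le {𝔽 E : Type*} [Field 𝔽] [AddCommGroup E] [Module 𝔽 E]
    [FiniteDimensional 𝔽 E] {V V' : Submodule 𝔽 E} (hV : V ≤ V') (W : Submodule 𝔽 E) :
    Module.finrank 𝔽 ↥(V' ⊓ W) + Module.finrank 𝔽 V ≤
      Module.finrank 𝔽 V' + Module.finrank 𝔽 ↥(V ⊓ W) := by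
  have hinf : V' ⊓ W ⊓ V = V ⊓ W := by
    rw [inf_right_comm, inf_eq_right.mpr hV]
  rw [← Submodule.finrank_sup_add_finrank_inf_eq (V' ⊓ W) V, hinf]
  exact Nat.add_le_add_right (Submodule.finrank_mono (sup_le inf_le_left hV)) _

/-- Column rank function of the `q`-polymatroid associated to
`C = Mat(V) + (Mat(U)ᵗ ∩ Mat(V'))`. -/
theorem stmt16 {𝔽 : Type*} [Field 𝔽] [Fintype 𝔽] {n m s h k : ℕ}
    (hn : 1 ≤ n) (hnm : n ≤ m) (hkm : k ≤ m) (hs : s ≤ m - h) (hshn : s + h ≤ n)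
    (C : Submodule 𝔽 (Matrix (Fin n) (Fin m) 𝔽))
    (hC : C = matCol (spanFirst 𝔽 n s) ⊔
        (matRow (spanFirst 𝔽 m k) ⊓ matCol (spanFirst 𝔽 n (s + h))))
    (J : Submodule 𝔽 (Fin n → 𝔽)) :
    Module.finrank 𝔽 C - Module.finrank 𝔽 ↥(C ⊓ matCol (perp J)) =
        m * (s - Module.finrank 𝔽 ↥(spanFirst 𝔽 n s ⊓ perp J)) +
          k * (h + Module.finrank 𝔽 ↥(spanFirst 𝔽 n s ⊓ perp J) -
            Module.finrank 𝔽 ↥(spanFirst 𝔽 n (s + h) ⊓ perp J)) ∧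
    ((Module.finrank 𝔽 C : ℚ) -
        (Module.finrank 𝔽 ↥(C ⊓ matCol (perp J)) : ℚ)) / (m : ℚ) =
      (s : ℚ) - (Module.finrank 𝔽 ↥(spanFirst 𝔽 n s ⊓ perp J) : ℚ) +
        (k : ℚ) * ((h : ℚ) + (Module.finrank 𝔽 ↥(spanFirst 𝔽 n s ⊓ perp J) : ℚ) -
          (Module.finrank 𝔽 ↥(spanFirst 𝔽 n (s + h) ⊓ perp J) : ℚ)) / (m : ℚ) := by
  have hV : spanFirst 𝔽 n s ≤ spanFirst 𝔽 n (s + h) := spanFirst_mono (Nat.le_add_right s h)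
  have hdimV : Module.finrank 𝔽 (spanFirst 𝔽 n s) = s := finrank_spanFirst (by omega)
  have hdimV' : Module.finrank 𝔽 (spanFirst 𝔽 n (s + h)) = s + h := finrank_spanFirst hshn
  have hmem : ∀ M, M ∈ C ↔ ∀ j : Fin m, (fun i => M i j) ∈
      if (j : ℕ) < k then spanFirst 𝔽 n (s + h) else spanFirst 𝔽 n s := by
    rw [hC]
    exact mem_matCol_sup_iff hV
  have hmemJ : ∀ M, M ∈ C ⊓ matCol (perp J) ↔ ∀ j : Fin m, (fun i => M i j) ∈
      if (j : ℕ) < k then spanFirst 𝔽 n (s + h) ⊓ perp J else spanFirst 𝔽 n s ⊓ perp J := by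
    intro M
    rw [Submodule.mem_inf, hmem M]
    change _ ∧ (∀ j, _) ↔ _
    rw [← forall_and]
    refine forall_congr' fun j => ?_
    split_ifs <;> exact Submodule.mem_inf.symm
  have hdimC : Module.finrank 𝔽 C = k * (s + h) + (m - k) * s := by
    rw [finrank_eq_sum_of_forall_col_mem hmem, ← sum_ite_val_lt hkm]
    refine Finset.sum_congr rfl fun j _ => ?_
    rw [apply_ite (fun W : Submodule 𝔽 (Fin n → 𝔽) => Module.finrank 𝔽 W), hdimV, hdimV']
  have hdimCJ : Module.finrank 𝔽 ↥(C ⊓ matCol (perp J)) =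
      k * Module.finrank 𝔽 ↥(spanFirst 𝔽 n (s + h) ⊓ perp J) +
        (m - k) * Module.finrank 𝔽 ↥(spanFirst 𝔽 n s ⊓ perp J) := by
    rw [finrank_eq_sum_of_forall_col_mem hmemJ, ← sum_ite_val_lt hkm]
    exact Finset.sum_congr rfl fun j _ =>
      apply_ite (fun W : Submodule 𝔽 (Fin n → 𝔽) => Module.finrank 𝔽 W) _ _ _
  have hle : Module.finrank 𝔽 ↥(spanFirst 𝔽 n s ⊓ perp J) ≤ s :=
    (Submodule.finrank_mono inf_le_left).trans hdimV.le
  have hle' := finrank_inf_add_finrank_le hV (perp J)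
  rw [hdimV, hdimV'] at hle'
  rw [hdimC, hdimCJ]
  generalize Module.finrank 𝔽 ↥(spanFirst 𝔽 n s ⊓ perp J) = a at *
  generalize Module.finrank 𝔽 ↥(spanFirst 𝔽 n (s + h) ⊓ perp J) = b at *
  obtain ⟨l, rfl⟩ := Nat.exists_eq_add_of_le hkm
  obtain ⟨c, rfl⟩ := Nat.exists_eq_add_of_le hle
  obtain ⟨d, hd⟩ := Nat.exists_eq_add_of_le (show b ≤ h + a by omega)
  constructor
  · rw [Nat.add_sub_cancel_left, Nat.add_sub_cancel_left, hd, Nat.add_sub_cancel_left,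
      add_assoc a c h, add_left_comm a c h, add_comm a h, hd]
    apply Nat.sub_eq_of_eq_add
    ring
  · have hm : ((k + l : ℕ) : ℚ) ≠ 0 := by
      exact_mod_cast (show k + l ≠ 0 by omega)
    rw [Nat.add_sub_cancel_left]
    field_simp
    push_cast
    ring
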